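/- Let X ⊆ ℝ^q be compact, γ > 0, and c : X × X → ℝ continuous with 0 ≤ c(x,y) ≤ M_c, G_c-Lipschitz in each variable, and continuously differentiable in its first variable with ‖∇₁c(x,y)‖ ≤ G_c. Then there exists a constant C, depending only on M_c, G_c and γ, such that for all probability measures α, α', β on X and all Sinkhorn potential pairs (f, g) for (α, β) and (f', g') for (α', β) (i.e. g = A(f, α), f = A(g, β), g' = A(f', α'), f' = A(g', β), normalized so that f(x₀) = f'(x₀) = 0 at a common point x₀ ∈ X), one has sup_{x ∈ X} ‖∇f(x) − ∇f'(x)‖ ≤ C · d_bl(α, α'). -/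

import Mathlib

open MeasureTheory

/-- The bounded-Lipschitz metric on measures supported in `X`. -/
noncomputable def dblOn {q : ℕ} (X : Set (EuclideanSpace ℝ (Fin q)))
    (α α' : Measure (EuclideanSpace ℝ (Fin q))) : ℝ :=
  sSup {r : ℝ | ∃ ξ : EuclideanSpace ℝ (Fin q) → ℝ,
    (∀ x ∈ X, |ξ x| ≤ 1) ∧ LipschitzOnWith 1 ξ X ∧
    r = |(∫ x, ξ x ∂α) - (∫ x, ξ x ∂α')|}

/-- The Sinkhorn mapping `A(f, μ)` with cost `c` and regularization `γ`. -/
noncomputable def sinkhornMap {E : Type*} [MeasurableSpace E] (γ : ℝ) (c : E → E → ℝ)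
    (μ : Measure E) (f : E → ℝ) (y : E) : ℝ :=
  -γ * Real.log (∫ x, Real.exp ((f x - c x y) / γ) ∂μ)

section SinkhornMap

lemma ae_mem_of_measure_compl_eq_zero {E : Type*} [MeasurableSpace E] {X : Set E}
    {μ : Measure E} (hμX : μ Xᶜ = 0) : ∀ᵐ x ∂μ, x ∈ X := by
  rw [ae_iff]; exact hμX

lemma ContinuousOn.gibbs {E : Type*} [TopologicalSpace E] {X : Set E} {γ : ℝ} {f k : E → ℝ}
    (hf : ContinuousOn f X) (hk : ContinuousOn k X) :
    ContinuousOn (fun x => Real.exp ((f x - k x) / γ)) X :=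
  Real.continuous_exp.comp_continuousOn ((hf.sub hk).div_const γ)

variable {E : Type*} [MetricSpace E] [MeasurableSpace E] [BorelSpace E]
  {X : Set E} {μ : Measure E}

lemma ContinuousOn.integrable_of_measure_compl_eq_zero {F : Type*} [NormedAddCommGroup F]
    [IsFiniteMeasure μ] (hX : IsCompact X) (hμX : μ Xᶜ = 0) {u : E → F}
    (hu : ContinuousOn u X) : Integrable u μ := by
  have h := hu.integrableOn_compact (μ := μ) hX
  rwa [IntegrableOn, Measure.restrict_eq_self_of_ae_mem
    (ae_mem_of_measure_compl_eq_zero hμX)] at h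

lemma integral_gibbs_pos [IsProbabilityMeasure μ] {γ : ℝ} (hX : IsCompact X) (hμX : μ Xᶜ = 0)
    {f k : E → ℝ} (hf : ContinuousOn f X) (hk : ContinuousOn k X) :
    0 < ∫ x, Real.exp ((f x - k x) / γ) ∂μ :=
  integral_exp_pos ((hf.gibbs hk).integrable_of_measure_compl_eq_zero hX hμX)

/-- The Sinkhorn mapping inherits the modulus of continuity of the cost. -/
lemma sinkhornMap_sub_le [IsProbabilityMeasure μ] {γ r : ℝ} (hγ : 0 < γ) (hX : IsCompact X)
    (hμX : μ Xᶜ = 0) {c : E → E → ℝ} {f : E → ℝ} (hf : ContinuousOn f X) {y z : E}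
    (hcy : ContinuousOn (fun x => c x y) X) (hcz : ContinuousOn (fun x => c x z) X)
    (hr : ∀ x ∈ X, c x y - c x z ≤ r) :
    sinkhornMap γ c μ f y - sinkhornMap γ c μ f z ≤ r := by
  have hy := integral_gibbs_pos (γ := γ) hX hμX hf hcy
  have hz := integral_gibbs_pos (γ := γ) hX hμX hf hcz
  have hle : ∫ x, Real.exp ((f x - c x z) / γ) ∂μ
      ≤ Real.exp (r / γ) * ∫ x, Real.exp ((f x - c x y) / γ) ∂μ := by
    rw [← integral_const_mul]
    refine integral_mono_ae ((hf.gibbs hcz).integrable_of_measure_compl_eq_zero hX hμX)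
      (((hf.gibbs hcy).integrable_of_measure_compl_eq_zero hX hμX).const_mul _) ?_
    filter_upwards [ae_mem_of_measure_compl_eq_zero hμX] with x hx
    rw [← Real.exp_add, ← add_div]
    gcongr
    linarith [hr x hx]
  have hlog := Real.log_le_log hz hle
  rw [Real.log_mul (Real.exp_pos _).ne' hy.ne', Real.log_exp] at hlog
  have h := mul_le_mul_of_nonneg_left hlog hγ.le
  rw [mul_add, mul_div_cancel₀ _ hγ.ne'] at h
  unfold sinkhornMap
  linarith

/-- Contraction of the Sinkhorn mapping for the oscillation seminorm. -/
lemma sinkhornMap_sub_sub_sub_le [IsProbabilityMeasure μ] {γ M D m : ℝ} (hγ : 0 < γ)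
    (hX : IsCompact X) (hμX : μ Xᶜ = 0) {c : E → E → ℝ} {f f' : E → ℝ}
    (hf : ContinuousOn f X) (hf' : ContinuousOn f' X)
    (hc : ∀ y ∈ X, ContinuousOn (fun x => c x y) X)
    (hcM : ∀ x ∈ X, ∀ y ∈ X, 0 ≤ c x y ∧ c x y ≤ M)
    (hm : ∀ x ∈ X, m ≤ f x - f' x) (hD : ∀ x ∈ X, f x - f' x ≤ m + D)
    {y z : E} (hy : y ∈ X) (hz : z ∈ X) :
    (sinkhornMap γ c μ f y - sinkhornMap γ c μ f' y)
      - (sinkhornMap γ c μ f z - sinkhornMap γ c μ f' z)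
      ≤ (1 - Real.exp (-(2 * M / γ))) * D := by
  set a : E → E → ℝ := fun y x => Real.exp ((f' x - c x y) / γ) with ha
  set b : E → E → ℝ := fun y x => Real.exp ((f x - c x y) / γ) with hb
  have hX' := ae_mem_of_measure_compl_eq_zero hμX
  have hai : ∀ y ∈ X, Integrable (a y) μ := fun y hy =>
    (hf'.gibbs (hc y hy)).integrable_of_measure_compl_eq_zero hX hμX
  have hbi : ∀ y ∈ X, Integrable (b y) μ := fun y hy =>
    (hf.gibbs (hc y hy)).integrable_of_measure_compl_eq_zero hX hμX
  have hapos : ∀ y ∈ X, 0 < ∫ x, a y x ∂μ := fun y hy => integral_gibbs_pos hX hμX hf' (hc y hy)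
  have hbpos : ∀ y ∈ X, 0 < ∫ x, b y x ∂μ := fun y hy => integral_gibbs_pos hX hμX hf (hc y hy)
  set e := Real.exp (-(m / γ)) with he
  have hepos : 0 < e := Real.exp_pos _
  set s := Real.exp (-(M / γ)) with hs
  have hspos : 0 < s := Real.exp_pos _
  have hs2 : Real.exp (-(2 * M / γ)) = s * s := by
    rw [hs, ← Real.exp_add]; congr 1; ring
  have hM : 0 ≤ M := (hcM y hy z hz).1.trans (hcM y hy z hz).2
  have hs1 : s ≤ 1 := by
    rw [hs, Real.exp_le_one_iff]
    have := div_nonneg hM hγ.le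
    linarith
  have hlow : ∀ y, ∀ x ∈ X, a y x ≤ e * b y x := by
    intro y x hx
    simp only [ha, hb, he]
    rw [← Real.exp_add, ← neg_div, ← add_div]
    gcongr
    linarith [hm x hx]
  have hup : ∀ y, ∀ x ∈ X, e * b y x ≤ Real.exp (D / γ) * a y x := by
    intro y x hx
    simp only [ha, hb, he]
    rw [← Real.exp_add, ← Real.exp_add, ← neg_div, ← add_div, ← add_div]
    refine Real.exp_le_exp.2 (div_le_div_of_nonneg_right ?_ hγ.le)
    linarith [hD x hx]
  have hcomp : ∀ y ∈ X, ∀ z ∈ X, ∀ x ∈ X, s * a z x ≤ a y x := by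
    intro y hy z hz x hx
    simp only [ha, hs]
    rw [← Real.exp_add, ← neg_div, ← add_div]
    gcongr
    linarith [(hcM x hx y hy).2, (hcM x hx z hz).1]
  have hZ : s * ∫ x, a y x ∂μ ≤ ∫ x, a z x ∂μ := by
    rw [← integral_const_mul]
    refine integral_mono_ae ((hai y hy).const_mul _) (hai z hz) ?_
    filter_upwards [hX'] with x hx using hcomp z hz y hy x hx
  have hW : s * (e * ∫ x, b z x ∂μ - ∫ x, a z x ∂μ) ≤ e * ∫ x, b y x ∂μ - ∫ x, a y x ∂μ := by
    rw [← integral_const_mul e, ← integral_const_mul e,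
      ← integral_sub ((hbi z hz).const_mul _) (hai z hz),
      ← integral_sub ((hbi y hy).const_mul _) (hai y hy), ← integral_const_mul]
    refine integral_mono_ae ((((hbi z hz).const_mul _).sub (hai z hz)).const_mul _)
      (((hbi y hy).const_mul _).sub (hai y hy)) ?_
    filter_upwards [hX'] with x hx
    have hb' : ∀ y, e * b y x - a y x = (Real.exp ((f x - f' x - m) / γ) - 1) * a y x := by
      intro y
      simp only [ha, hb, he]
      rw [sub_mul, ← Real.exp_add, ← Real.exp_add, one_mul]
      congr 2
      ring
    have h1 : 0 ≤ Real.exp ((f x - f' x - m) / γ) - 1 := by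
      rw [sub_nonneg, Real.one_le_exp_iff]
      exact div_nonneg (by linarith [hm x hx]) hγ.le
    simp only [hb']
    nlinarith [mul_le_mul_of_nonneg_left (hcomp y hy z hz x hx) h1]
  have hT : e * ∫ x, b z x ∂μ ≤ Real.exp (D / γ) * ∫ x, a z x ∂μ := by
    rw [← integral_const_mul, ← integral_const_mul]
    refine integral_mono_ae ((hbi z hz).const_mul _) ((hai z hz).const_mul _) ?_
    filter_upwards [hX'] with x hx using hup z x hx
  have hT1 : ∫ x, a z x ∂μ ≤ e * ∫ x, b z x ∂μ := by
    rw [← integral_const_mul]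
    refine integral_mono_ae (hai z hz) ((hbi z hz).const_mul _) ?_
    filter_upwards [hX'] with x hx using hlow z x hx
  have haz := hapos z hz
  have hay := hapos y hy
  have hbz := hbpos z hz
  have hby := hbpos y hy
  have hgoal : (sinkhornMap γ c μ f y - sinkhornMap γ c μ f' y)
      - (sinkhornMap γ c μ f z - sinkhornMap γ c μ f' z)
      = γ * (Real.log (∫ x, b z x ∂μ) - Real.log (∫ x, a z x ∂μ)
        - (Real.log (∫ x, b y x ∂μ) - Real.log (∫ x, a y x ∂μ))) := by
    simp only [sinkhornMap, ha, hb]; ring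
  rw [hgoal, hs2]
  generalize (∫ x, b z x ∂μ) = Bz at *
  generalize (∫ x, a z x ∂μ) = Az at *
  generalize (∫ x, b y x ∂μ) = By at *
  generalize (∫ x, a y x ∂μ) = Ay at *
  set t := e * Bz / Az with ht
  set p := e * By / Ay with hp
  have htpos : 0 < t := by positivity
  have hppos : 0 < p := by positivity
  have ht1 : 1 ≤ t := by rw [ht, one_le_div haz]; exact hT1
  have htE : t ≤ Real.exp (D / γ) := by rw [ht, div_le_iff₀ haz]; exact hT
  have htp : s * s * (t - 1) ≤ p - 1 := by
    have e1 : t - 1 = (e * Bz - Az) / Az := by rw [ht]; field_simp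
    have e2 : p - 1 = (e * By - Ay) / Ay := by rw [hp]; field_simp
    rw [e1, e2, le_div_iff₀ hay, mul_div_assoc', div_mul_eq_mul_div, div_le_iff₀ haz]
    have h0 : 0 ≤ e * Bz - Az := by linarith
    have h2 : 0 ≤ s * (e * Bz - Az) := mul_nonneg hspos.le h0
    calc s * s * (e * Bz - Az) * Ay = (s * (e * Bz - Az)) * (s * Ay) := by ring
      _ ≤ (s * (e * Bz - Az)) * Az := mul_le_mul_of_nonneg_left hZ h2
      _ ≤ (e * By - Ay) * Az := mul_le_mul_of_nonneg_right hW haz.le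
  have hlt : Real.log Bz - Real.log Az = Real.log t - Real.log e := by
    rw [ht, Real.log_div (by positivity) haz.ne', Real.log_mul hepos.ne' hbz.ne']; ring
  have hlp : Real.log By - Real.log Ay = Real.log p - Real.log e := by
    rw [hp, Real.log_div (by positivity) hay.ne', Real.log_mul hepos.ne' hby.ne']; ring
  have hss : s * s ≤ 1 := by nlinarith
  have hconc : s * s * Real.log t ≤ Real.log p := by
    have h := strictConcaveOn_log_Ioi.concaveOn.2 (Set.mem_Ioi.2 htpos)
      (Set.mem_Ioi.2 one_pos) (mul_nonneg hspos.le hspos.le) (sub_nonneg.2 hss) (by ring)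
    simp only [smul_eq_mul, Real.log_one, mul_zero, add_zero] at h
    refine h.trans (Real.log_le_log (by nlinarith [mul_pos hspos hspos]) (by linarith))
  have hlE : Real.log t ≤ D / γ := by
    rw [← Real.log_exp (D / γ)]; exact Real.log_le_log htpos htE
  rw [hlt, hlp]
  have h1 : Real.log t - Real.log e - (Real.log p - Real.log e) ≤ (1 - s * s) * (D / γ) := by
    have := mul_le_mul_of_nonneg_left hlE (sub_nonneg.2 hss)
    linarith
  calc _ ≤ γ * ((1 - s * s) * (D / γ)) := mul_le_mul_of_nonneg_left h1 hγ.le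
    _ = (1 - s * s) * D := by field_simp

end SinkhornMap

section Gradient

variable {E : Type*} [NormedAddCommGroup E] [InnerProductSpace ℝ E]
  [MeasurableSpace E] [BorelSpace E] {X : Set E} {μ : Measure E}

/-- The gradient of a Sinkhorn potential is the Gibbs average of the gradient of the cost. -/
lemma hasGradientAt_sinkhornMap [CompleteSpace E] [IsProbabilityMeasure μ] {γ G M : ℝ} (hγ : 0 < γ)
    (hX : IsCompact X) (hμX : μ Xᶜ = 0) {c : E → E → ℝ} {Dc : E → E → E} {g : E → ℝ}
    (hg : ContinuousOn g X) (hc : ∀ x ∈ X, ContinuousOn (fun y => c x y) X)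
    (hcM : ∀ x ∈ X, ∀ y ∈ X, 0 ≤ c x y ∧ c x y ≤ M)
    (hDc : ∀ y ∈ X, ∀ x ∈ interior X, HasGradientAt (fun x' => c x' y) (Dc x y) x)
    (hDcc : ∀ x ∈ interior X, ContinuousOn (fun y => Dc x y) X)
    (hDcG : ∀ x ∈ interior X, ∀ y ∈ X, ‖Dc x y‖ ≤ G) {x : E} (hx : x ∈ interior X) :
    HasGradientAt (sinkhornMap γ (fun y x => c x y) μ g)
      ((∫ y, Real.exp ((g y - c x y) / γ) ∂μ)⁻¹ •
        ∫ y, Real.exp ((g y - c x y) / γ) • Dc x y ∂μ) x := by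
  have hX' := ae_mem_of_measure_compl_eq_zero hμX
  have hnhds : interior X ∈ nhds x := isOpen_interior.mem_nhds hx
  have hxX := interior_subset hx
  have hG : 0 ≤ G := (norm_nonneg _).trans (hDcG x hx x hxX)
  have hcont : ∀ x ∈ X, ContinuousOn (fun y => Real.exp ((g y - c x y) / γ)) X :=
    fun x hx => hg.gibbs (hc x hx)
  have hvc : ContinuousOn (fun y => Real.exp ((g y - c x y) / γ) • Dc x y) X :=
    (hcont x hxX).smul (hDcc x hx)
  have hvi := hvc.integrable_of_measure_compl_eq_zero hX hμX
  have hd := hasFDerivAt_integral_of_dominated_of_fderiv_le (μ := μ) (x₀ := x)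
    (F := fun x y => Real.exp ((g y - c x y) / γ))
    (F' := fun x y => (-γ⁻¹) • innerSL ℝ (Real.exp ((g y - c x y) / γ) • Dc x y))
    (bound := fun y => γ⁻¹ * (Real.exp (g y / γ) * G)) hnhds ?_ ?_ ?_ ?_ ?_ ?_
  · have hpos := integral_gibbs_pos (γ := γ) hX hμX hg (hc x hxX)
    have hl := (hd.log hpos.ne').const_mul (-γ)
    unfold HasGradientAt
    refine hl.congr_fderiv ?_
    rw [integral_smul, ContinuousLinearMap.integral_comp_comm _ hvi]
    ext v
    simp only [smul_apply, smul_eq_mul,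
      InnerProductSpace.toDual_apply_apply, inner_smul_left]
    simp only [conj_trivial]
    field_simp
    exact innerSL_apply_apply ℝ _ _
  · filter_upwards [hnhds] with z hz
    exact ((hcont z (interior_subset hz)).integrable_of_measure_compl_eq_zero hX hμX).1
  · exact (hcont x hxX).integrable_of_measure_compl_eq_zero hX hμX
  · exact ((((innerSL ℝ).continuous.comp_continuousOn hvc).const_smul
      (-γ⁻¹)).integrable_of_measure_compl_eq_zero hX hμX).1
  · filter_upwards [hX'] with y hy z hz
    rw [norm_smul, innerSL_apply_norm, norm_smul, norm_neg, norm_inv, Real.norm_of_nonneg hγ.le,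
      Real.norm_of_nonneg (Real.exp_pos _).le]
    gcongr
    · linarith [(hcM z (interior_subset hz) y hy).1]
    · exact hDcG z hz y hy
  · exact ((((Real.continuous_exp.comp_continuousOn (hg.div_const γ)).mul
      continuousOn_const).const_mul γ⁻¹)).integrable_of_measure_compl_eq_zero hX hμX
  · filter_upwards [hX'] with y hy z hz
    have h := (((hDc y hy z hz).hasFDerivAt.const_sub (g y)).mul_const γ⁻¹).exp
    simp only [← div_eq_mul_inv] at h
    refine h.congr_fderiv ?_
    ext v
    simp only [smul_apply, neg_apply, innerSL_apply_apply,
      smul_eq_mul, InnerProductSpace.toDual_apply_apply, inner_smul_left, conj_trivial]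
    ring

/-- Gibbs averages of a bounded function depend Lipschitz-continuously on the oscillation of
the potential. -/
lemma norm_gibbs_average_sub_le [IsProbabilityMeasure μ] {γ G D m : ℝ} (hγ : 0 < γ)
    (hX : IsCompact X) (hμX : μ Xᶜ = 0) {g g' k : E → ℝ} {v : E → E}
    (hg : ContinuousOn g X) (hg' : ContinuousOn g' X) (hk : ContinuousOn k X)
    (hv : ContinuousOn v X) (hvG : ∀ y ∈ X, ‖v y‖ ≤ G)
    (hm : ∀ y ∈ X, m ≤ g y - g' y) (hD : ∀ y ∈ X, g y - g' y ≤ m + D) :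
    ‖(∫ y, Real.exp ((g y - k y) / γ) ∂μ)⁻¹ • ∫ y, Real.exp ((g y - k y) / γ) • v y ∂μ
      - (∫ y, Real.exp ((g' y - k y) / γ) ∂μ)⁻¹ • ∫ y, Real.exp ((g' y - k y) / γ) • v y ∂μ‖
      ≤ G * (Real.exp (D / γ) - 1) := by
  have hX' := ae_mem_of_measure_compl_eq_zero hμX
  have hac := hg.gibbs (γ := γ) hk
  have hac' := hg'.gibbs (γ := γ) hk
  have hZ := integral_gibbs_pos (γ := γ) hX hμX hg hk
  have hZ' := integral_gibbs_pos (γ := γ) hX hμX hg' hk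
  set a := fun y => Real.exp ((g y - k y) / γ) with ha
  set a' := fun y => Real.exp ((g' y - k y) / γ) with ha'
  have hai := hac.integrable_of_measure_compl_eq_zero hX hμX
  have hai' := hac'.integrable_of_measure_compl_eq_zero hX hμX
  have hlow : ∀ y ∈ X, Real.exp (m / γ) * a' y ≤ a y := by
    intro y hy
    simp only [ha, ha']
    rw [← Real.exp_add, ← add_div]
    gcongr
    linarith [hm y hy]
  have hup : ∀ y ∈ X, a y ≤ Real.exp (D / γ) * (Real.exp (m / γ) * a' y) := by
    intro y hy
    simp only [ha, ha']
    rw [← Real.exp_add, ← Real.exp_add, ← add_div, ← add_div]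
    gcongr
    linarith [hD y hy]
  have hZlow : Real.exp (m / γ) * ∫ y, a' y ∂μ ≤ ∫ y, a y ∂μ := by
    rw [← integral_const_mul]
    refine integral_mono_ae (hai'.const_mul _) hai ?_
    filter_upwards [hX'] with y hy using hlow y hy
  have hZup : ∫ y, a y ∂μ ≤ Real.exp (D / γ) * (Real.exp (m / γ) * ∫ y, a' y ∂μ) := by
    rw [← integral_const_mul, ← integral_const_mul]
    refine integral_mono_ae hai ((hai'.const_mul _).const_mul _) ?_
    filter_upwards [hX'] with y hy using hup y hy
  have havi : Integrable (fun y => a y • v y) μ :=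
    (hac.smul hv).integrable_of_measure_compl_eq_zero hX hμX
  have havi' : Integrable (fun y => a' y • v y) μ :=
    (hac'.smul hv).integrable_of_measure_compl_eq_zero hX hμX
  change ‖(∫ y, a y ∂μ)⁻¹ • ∫ y, a y • v y ∂μ - (∫ y, a' y ∂μ)⁻¹ • ∫ y, a' y • v y ∂μ‖ ≤ _
  have hZint : (∫ y, a' y ∂μ)⁻¹ * ∫ y, a' y ∂μ = 1 := inv_mul_cancel₀ hZ'.ne'
  rw [← integral_smul, ← integral_smul,
    ← integral_sub (f := fun y => _ • a y • v y) (g := fun y => _ • a' y • v y)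
      (havi.smul _) (havi'.smul _)]
  have hbound : ∀ᵐ y ∂μ, ‖(∫ y, a y ∂μ)⁻¹ • a y • v y - (∫ y, a' y ∂μ)⁻¹ • a' y • v y‖
      ≤ (G * (Real.exp (D / γ) - 1)) * ((∫ y, a' y ∂μ)⁻¹ * a' y) := by
    filter_upwards [hX'] with y hy
    have hl := hlow y hy
    have hu := hup y hy
    have hay' : 0 < a' y := Real.exp_pos _
    have hay : 0 < a y := Real.exp_pos _
    have hvy := hvG y hy
    have hepos := Real.exp_pos (m / γ)
    have hEpos := Real.exp_pos (D / γ)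
    rw [smul_smul, smul_smul, ← sub_smul, norm_smul, Real.norm_eq_abs]
    generalize (∫ y, a y ∂μ) = Z at *
    generalize (∫ y, a' y ∂μ) = Z' at *
    generalize a y = A at *
    generalize a' y = A' at *
    generalize Real.exp (m / γ) = e at *
    generalize Real.exp (D / γ) = F at *
    have h1 : Z⁻¹ * A ≤ F * (Z'⁻¹ * A') := by
      rw [inv_mul_eq_div, inv_mul_eq_div, mul_div_assoc', div_le_div_iff₀ hZ hZ']
      calc A * Z' ≤ F * (e * A') * Z' := by gcongr
        _ = F * A' * (e * Z') := by ring
        _ ≤ F * A' * Z := by gcongr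
    have h2 : Z'⁻¹ * A' ≤ F * (Z⁻¹ * A) := by
      rw [inv_mul_eq_div, inv_mul_eq_div, mul_div_assoc', div_le_div_iff₀ hZ' hZ]
      calc A' * Z ≤ A' * (F * (e * Z')) := by gcongr
        _ = F * (e * A') * Z' := by ring
        _ ≤ F * A * Z' := by gcongr
    have hF : 1 ≤ F := by
      have h3 : 0 < e * A' := by positivity
      by_contra! h4
      nlinarith
    have hp : 0 < Z⁻¹ * A := by positivity
    have hp' : 0 < Z'⁻¹ * A' := by positivity
    have habs : |Z⁻¹ * A - Z'⁻¹ * A'| ≤ (F - 1) * (Z'⁻¹ * A') := by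
      rw [abs_le]
      constructor
      · rcases le_total (Z'⁻¹ * A') (Z⁻¹ * A) with h | h
        · have := mul_nonneg (sub_nonneg.2 hF) hp'.le
          linarith
        · have := mul_le_mul_of_nonneg_left h (sub_nonneg.2 hF)
          linarith
      · linarith
    calc _ ≤ (F - 1) * (Z'⁻¹ * A') * G := by gcongr
      _ = _ := by ring
  refine (norm_integral_le_of_norm_le ((hai'.const_mul _).const_mul _) hbound).trans ?_
  rw [integral_const_mul, integral_const_mul, hZint, mul_one]

end Gradient

section BoundedLipschitz

variable {q : ℕ} {X : Set (EuclideanSpace ℝ (Fin q))}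
  {α α' : Measure (EuclideanSpace ℝ (Fin q))}

lemma abs_integral_le_of_abs_le [IsProbabilityMeasure α] (hαX : α Xᶜ = 0)
    {ξ : EuclideanSpace ℝ (Fin q) → ℝ} {B : ℝ} (hξ : ∀ x ∈ X, |ξ x| ≤ B) :
    |∫ x, ξ x ∂α| ≤ B := by
  have h := norm_integral_le_of_norm_le_const (μ := α) (f := ξ) (C := B)
    (by filter_upwards [ae_mem_of_measure_compl_eq_zero hαX] with x hx using hξ x hx)
  simpa using h

lemma abs_integral_sub_le_dblOn [IsProbabilityMeasure α] [IsProbabilityMeasure α']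
    (hαX : α Xᶜ = 0) (hαX' : α' Xᶜ = 0) {ξ : EuclideanSpace ℝ (Fin q) → ℝ}
    (hξ : ∀ x ∈ X, |ξ x| ≤ 1) (hL : LipschitzOnWith 1 ξ X) :
    |(∫ x, ξ x ∂α) - (∫ x, ξ x ∂α')| ≤ dblOn X α α' := by
  refine le_csSup ⟨2, ?_⟩ ⟨ξ, hξ, hL, rfl⟩
  rintro r ⟨η, hη, -, rfl⟩
  have h1 := abs_integral_le_of_abs_le hαX hη
  have h2 := abs_integral_le_of_abs_le hαX' hη
  have := abs_sub (∫ x, η x ∂α) (∫ x, η x ∂α')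
  linarith

lemma integral_sub_le_mul_dblOn [IsProbabilityMeasure α] [IsProbabilityMeasure α']
    (hαX : α Xᶜ = 0) (hαX' : α' Xᶜ = 0) {ξ : EuclideanSpace ℝ (Fin q) → ℝ} {K : ℝ} (hK : 0 < K)
    (hξ : ∀ x ∈ X, |ξ x| ≤ K) (hL : ∀ x ∈ X, ∀ z ∈ X, |ξ x - ξ z| ≤ K * ‖x - z‖) :
    |(∫ x, ξ x ∂α) - (∫ x, ξ x ∂α')| ≤ K * dblOn X α α' := by
  have h := abs_integral_sub_le_dblOn (ξ := fun x => K⁻¹ * ξ x) hαX hαX' ?_ ?_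
  · rw [integral_const_mul, integral_const_mul, ← mul_sub, abs_mul, abs_of_pos (inv_pos.2 hK),
      inv_mul_le_iff₀ hK] at h
    exact h
  · intro x hx
    rw [abs_mul, abs_of_pos (inv_pos.2 hK), inv_mul_le_iff₀ hK, mul_one]
    exact hξ x hx
  · refine LipschitzOnWith.of_dist_le_mul fun x hx z hz => ?_
    rw [Real.dist_eq, ← mul_sub, abs_mul, abs_of_pos (inv_pos.2 hK), inv_mul_le_iff₀ hK,
      dist_eq_norm, NNReal.coe_one, one_mul]
    exact hL x hx z hz

lemma dblOn_comm (α α' : Measure (EuclideanSpace ℝ (Fin q))) : dblOn X α α' = dblOn X α' α := by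
  simp only [dblOn, abs_sub_comm]

lemma abs_exp_sub_exp_le {a b B : ℝ} (ha : a ≤ B) (hb : b ≤ B) :
    |Real.exp a - Real.exp b| ≤ Real.exp B * |a - b| := by
  wlog h : b ≤ a generalizing a b
  · rw [abs_sub_comm, abs_sub_comm a]
    exact this hb ha (le_of_not_ge h)
  rw [abs_of_nonneg (sub_nonneg.2 (Real.exp_le_exp.2 h)), abs_of_nonneg (sub_nonneg.2 h)]
  have h1 := mul_le_mul_of_nonneg_left (Real.add_one_le_exp (b - a)) (Real.exp_pos a).le
  rw [← Real.exp_add, add_sub_cancel] at h1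
  have h2 := mul_le_mul_of_nonneg_right (Real.exp_le_exp.2 ha) (sub_nonneg.2 h)
  linarith

/-- Lipschitz dependence of the Sinkhorn mapping on the measure. -/
lemma sinkhornMap_sub_le_dblOn [IsProbabilityMeasure α] [IsProbabilityMeasure α']
    {γ M G : ℝ} (hγ : 0 < γ) (hG : 0 ≤ G) (hX : IsCompact X) (hαX : α Xᶜ = 0) (hαX' : α' Xᶜ = 0)
    {c : EuclideanSpace ℝ (Fin q) → EuclideanSpace ℝ (Fin q) → ℝ}
    {f : EuclideanSpace ℝ (Fin q) → ℝ} {y : EuclideanSpace ℝ (Fin q)}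
    (hf : ContinuousOn f X) (hc : ContinuousOn (fun x => c x y) X)
    (hcM : ∀ x ∈ X, 0 ≤ c x y ∧ c x y ≤ M)
    (hcG : ∀ x ∈ X, ∀ z ∈ X, |c x y - c z y| ≤ G * ‖x - z‖)
    (hfM : ∀ x ∈ X, |f x| ≤ M) (hfG : ∀ x ∈ X, ∀ z ∈ X, |f x - f z| ≤ G * ‖x - z‖) :
    sinkhornMap γ c α' f y - sinkhornMap γ c α f y
      ≤ γ * (Real.exp (2 * M / γ) * (Real.exp (M / γ) * (1 + 2 * G / γ))) * dblOn X α α' := by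
  set ξ := fun x => Real.exp ((f x - c x y) / γ) with hξ
  have hup : ∀ x ∈ X, (f x - c x y) / γ ≤ M / γ := by
    intro x hx
    gcongr
    linarith [(abs_le.1 (hfM x hx)).2, (hcM x hx).1]
  have hlow : ∀ x ∈ X, Real.exp (-(2 * M / γ)) ≤ ξ x := by
    intro x hx
    simp only [hξ]
    rw [← neg_div]
    gcongr
    linarith [(abs_le.1 (hfM x hx)).1, (hcM x hx).2]
  have hdiff := integral_sub_le_mul_dblOn (ξ := ξ) (K := Real.exp (M / γ) * (1 + 2 * G / γ))
    hαX hαX' (by positivity) ?_ ?_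
  · have hA := integral_gibbs_pos (γ := γ) hX hαX hf hc
    have hA' := integral_gibbs_pos (γ := γ) hX hαX' hf hc
    have hAlow : Real.exp (-(2 * M / γ)) ≤ ∫ x, ξ x ∂α' := by
      have h := integral_mono_ae (μ := α') (integrable_const (Real.exp (-(2 * M / γ))))
        ((hf.gibbs (γ := γ) hc).integrable_of_measure_compl_eq_zero hX hαX')
        (by filter_upwards [ae_mem_of_measure_compl_eq_zero hαX'] with x hx using hlow x hx)
      simpa using h
    have hgoal : sinkhornMap γ c α' f y - sinkhornMap γ c α f y
        = γ * (Real.log (∫ x, ξ x ∂α) - Real.log (∫ x, ξ x ∂α')) := by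
      simp only [sinkhornMap, hξ]; ring
    rw [hgoal, mul_assoc]
    refine mul_le_mul_of_nonneg_left ?_ hγ.le
    change 0 < ∫ x, ξ x ∂α at hA
    change 0 < ∫ x, ξ x ∂α' at hA'
    rw [← Real.log_div hA.ne' hA'.ne']
    refine (Real.log_le_sub_one_of_pos (div_pos hA hA')).trans ?_
    rw [div_sub_one hA'.ne', mul_assoc, div_eq_inv_mul]
    have hinv : (∫ x, ξ x ∂α')⁻¹ ≤ Real.exp (2 * M / γ) := by
      rw [← neg_neg (2 * M / γ), Real.exp_neg (-(2 * M / γ))]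
      exact inv_anti₀ (Real.exp_pos _) hAlow
    calc _ ≤ (∫ x, ξ x ∂α')⁻¹ * |(∫ x, ξ x ∂α) - ∫ x, ξ x ∂α'| :=
          mul_le_mul_of_nonneg_left (le_abs_self _) (inv_pos.2 hA').le
      _ ≤ _ := mul_le_mul hinv hdiff (abs_nonneg _) (Real.exp_pos _).le
  · intro x hx
    rw [abs_of_pos (Real.exp_pos _)]
    have h1 : 0 ≤ 2 * G / γ := by positivity
    have h2 := Real.exp_le_exp.2 (hup x hx)
    have h3 := mul_nonneg (Real.exp_pos (M / γ)).le h1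
    linarith
  · intro x hx z hz
    refine (abs_exp_sub_exp_le (hup x hx) (hup z hz)).trans ?_
    rw [mul_assoc]
    refine mul_le_mul_of_nonneg_left ?_ (Real.exp_pos _).le
    rw [← sub_div, abs_div, abs_of_pos hγ, div_le_iff₀ hγ]
    have h1 := hfG x hx z hz
    have h2 := hcG x hx z hz
    have h3 := abs_sub (f x - f z) (c x y - c z y)
    have e : f x - c x y - (f z - c z y) = f x - f z - (c x y - c z y) := by ring
    rw [e]
    have e2 : (1 + 2 * G / γ) * ‖x - z‖ * γ = ‖x - z‖ * γ + 2 * (G * ‖x - z‖) := by field_simp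
    rw [e2]
    have := mul_nonneg (norm_nonneg (x - z)) hγ.le
    linarith

end BoundedLipschitz

/-- **Lipschitz stability of the gradient of the Sinkhorn potential w.r.t. the
first marginal.** There is a constant `C`, depending only on `M_c`, `G_c` and `γ`,
such that for all marginals and all normalized Sinkhorn potential pairs `(f, g)`
for `(α, β)` and `(f', g')` for `(α', β)` one has
`sup_x ‖∇f(x) - ∇f'(x)‖ ≤ C · d_bl(α, α')`. -/
theorem sinkhorn_potential_gradient_stability
    {q : ℕ} (γ Mc Gc : ℝ) (hγ : 0 < γ) :
    ∃ C : ℝ,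
    ∀ (X : Set (EuclideanSpace ℝ (Fin q))), IsCompact X →
    ∀ (c : EuclideanSpace ℝ (Fin q) → EuclideanSpace ℝ (Fin q) → ℝ),
    ContinuousOn (fun p : EuclideanSpace ℝ (Fin q) × EuclideanSpace ℝ (Fin q) =>
      c p.1 p.2) (X ×ˢ X) →
    (∀ x ∈ X, ∀ y ∈ X, 0 ≤ c x y ∧ c x y ≤ Mc) →
    (∀ y ∈ X, ∀ x ∈ X, ∀ x' ∈ X, |c x y - c x' y| ≤ Gc * ‖x - x'‖) →
    (∀ x ∈ X, ∀ y ∈ X, ∀ y' ∈ X, |c x y - c x y'| ≤ Gc * ‖y - y'‖) →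
    ∀ (Dc : EuclideanSpace ℝ (Fin q) → EuclideanSpace ℝ (Fin q) → EuclideanSpace ℝ (Fin q)),
    (∀ y ∈ X, ∀ x ∈ interior X, HasGradientAt (fun x' => c x' y) (Dc x y) x) →
    ContinuousOn (fun p : EuclideanSpace ℝ (Fin q) × EuclideanSpace ℝ (Fin q) =>
      Dc p.1 p.2) ((interior X) ×ˢ X) →
    (∀ x ∈ interior X, ∀ y ∈ X, ‖Dc x y‖ ≤ Gc) →
    ∀ (α α' β : Measure (EuclideanSpace ℝ (Fin q))),
    IsProbabilityMeasure α → IsProbabilityMeasure α' → IsProbabilityMeasure β →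
    α Xᶜ = 0 → α' Xᶜ = 0 → β Xᶜ = 0 →
    ∀ (f g f' g' : EuclideanSpace ℝ (Fin q) → ℝ),
    ContinuousOn f X → ContinuousOn g X → ContinuousOn f' X → ContinuousOn g' X →
    (∀ y ∈ X, g y = -γ * Real.log (∫ x, Real.exp ((f x - c x y) / γ) ∂α)) →
    (∀ x ∈ X, f x = -γ * Real.log (∫ y, Real.exp ((g y - c x y) / γ) ∂β)) →
    (∀ y ∈ X, g' y = -γ * Real.log (∫ x, Real.exp ((f' x - c x y) / γ) ∂α')) →
    (∀ x ∈ X, f' x = -γ * Real.log (∫ y, Real.exp ((g' y - c x y) / γ) ∂β)) →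
    ∀ x₀ ∈ X, f x₀ = 0 → f' x₀ = 0 →
    ∀ x ∈ interior X, ‖gradient f x - gradient f' x‖ ≤ C * dblOn X α α' := by
  set K := γ * (Real.exp (2 * Mc / γ) * (Real.exp (Mc / γ) * (1 + 2 * Gc / γ))) with hK
  refine ⟨Gc * (Real.exp (2 * Mc / γ) / γ * (Real.exp (2 * Mc / γ) * (2 * K))), ?_⟩
  intro X hX c hc hcM hcL hcR Dc hDc hDcc hDcG α α' β hα hα' hβ hαX hα'X hβX f g f' g'
    hf hg hf' hg' hgA hfA hgA' hfA' x₀ hx₀ hfx₀ hfx₀' x hx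
  have hxX := interior_subset hx
  have hG : 0 ≤ Gc := (norm_nonneg _).trans (hDcG x hx x hxX)
  have hM : 0 ≤ Mc := (hcM x hxX x hxX).1.trans (hcM x hxX x hxX).2
  have hcx : ∀ x ∈ X, ContinuousOn (fun y => c x y) X := fun x hx =>
    hc.comp (continuousOn_const.prodMk continuousOn_id) fun y hy => ⟨hx, hy⟩
  have hcy : ∀ y ∈ X, ContinuousOn (fun x => c x y) X := fun y hy =>
    hc.comp (continuousOn_id.prodMk continuousOn_const) fun x hx => ⟨hx, hy⟩
  have hDcx : ∀ x ∈ interior X, ContinuousOn (fun y => Dc x y) X := fun x hx =>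
    hDcc.comp (continuousOn_const.prodMk continuousOn_id) fun y hy => ⟨hx, hy⟩
  replace hgA : ∀ y ∈ X, g y = sinkhornMap γ c α f y := hgA
  replace hgA' : ∀ y ∈ X, g' y = sinkhornMap γ c α' f' y := hgA'
  replace hfA : ∀ x ∈ X, f x = sinkhornMap γ (fun y x => c x y) β g x := hfA
  replace hfA' : ∀ x ∈ X, f' x = sinkhornMap γ (fun y x => c x y) β g' x := hfA'
  have hcdiff : ∀ x ∈ X, ∀ y ∈ X, ∀ x' ∈ X, ∀ y' ∈ X, c x y - c x' y' ≤ Mc := by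
    intro x hx y hy x' hx' y' hy'
    linarith [(hcM x hx y hy).2, (hcM x' hx' y' hy').1]
  have hgosc : ∀ y ∈ X, ∀ z ∈ X, g y - g z ≤ Mc := by
    intro y hy z hz
    rw [hgA y hy, hgA z hz]
    exact sinkhornMap_sub_le hγ hX hαX hf (hcy y hy) (hcy z hz)
      fun x hx => hcdiff x hx y hy x hx z hz
  have hgosc' : ∀ y ∈ X, ∀ z ∈ X, g' y - g' z ≤ Mc := by
    intro y hy z hz
    rw [hgA' y hy, hgA' z hz]
    exact sinkhornMap_sub_le hγ hX hα'X hf' (hcy y hy) (hcy z hz)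
      fun x hx => hcdiff x hx y hy x hx z hz
  have hfosc' : ∀ y ∈ X, ∀ z ∈ X, f' y - f' z ≤ Mc := by
    intro y hy z hz
    rw [hfA' y hy, hfA' z hz]
    exact sinkhornMap_sub_le hγ hX hβX hg' (hcx y hy) (hcx z hz)
      fun x hx => hcdiff y hy x hx z hz x hx
  have hfM' : ∀ y ∈ X, |f' y| ≤ Mc := by
    intro y hy
    have h1 := hfosc' y hy x₀ hx₀
    have h2 := hfosc' x₀ hx₀ y hy
    rw [abs_le]
    constructor <;> linarith
  have hfle' : ∀ y ∈ X, ∀ z ∈ X, f' y - f' z ≤ Gc * ‖y - z‖ := by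
    intro y hy z hz
    rw [hfA' y hy, hfA' z hz]
    exact sinkhornMap_sub_le hγ hX hβX hg' (hcx y hy) (hcx z hz)
      fun x hx => (le_abs_self _).trans (hcL x hx y hy z hz)
  have hfG' : ∀ y ∈ X, ∀ z ∈ X, |f' y - f' z| ≤ Gc * ‖y - z‖ := by
    intro y hy z hz
    refine abs_sub_le_iff.2 ⟨hfle' y hy z hz, ?_⟩
    rw [norm_sub_rev]
    exact hfle' z hz y hy
  obtain ⟨y₁, hy₁, hmax⟩ := hX.exists_isMaxOn ⟨x, hxX⟩ (hg.sub hg')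
  obtain ⟨y₂, hy₂, hmin⟩ := hX.exists_isMinOn ⟨x, hxX⟩ (hg.sub hg')
  obtain ⟨x₂, hx₂, hmin'⟩ := hX.exists_isMinOn ⟨x, hxX⟩ (hf.sub hf')
  replace hmax : ∀ y ∈ X, g y - g' y ≤ g y₁ - g' y₁ := fun y hy => hmax hy
  replace hmin : ∀ y ∈ X, g y₂ - g' y₂ ≤ g y - g' y := fun y hy => hmin hy
  replace hmin' : ∀ y ∈ X, f x₂ - f' x₂ ≤ f y - f' y := fun y hy => hmin' hy
  set D := (g y₁ - g' y₁) - (g y₂ - g' y₂) with hD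
  have hD0 : 0 ≤ D := sub_nonneg.2 (hmin y₁ hy₁)
  have hgD : ∀ y ∈ X, g y - g' y ≤ (g y₂ - g' y₂) + D := fun y hy => by
    linarith [hmax y hy]
  set κ := Real.exp (-(2 * Mc / γ)) with hκ
  have hκ0 : 0 < κ := Real.exp_pos _
  have hκ1 : κ ≤ 1 := by
    rw [hκ, Real.exp_le_one_iff, neg_nonpos]
    positivity
  have hfD : ∀ y ∈ X, f y - f' y ≤ (f x₂ - f' x₂) + (1 - κ) * D := by
    intro y hy
    have h := sinkhornMap_sub_sub_sub_le (c := fun y x => c x y) hγ hX hβX hg hg' hcx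
      (fun y hy x hx => hcM x hx y hy) hmin hgD hy hx₂
    rw [← hfA y hy, ← hfA' y hy, ← hfA x₂ hx₂, ← hfA' x₂ hx₂] at h
    linarith
  have hcontr := sinkhornMap_sub_sub_sub_le hγ hX hαX hf hf' hcy hcM hmin' hfD hy₁ hy₂
  have hst₁ := sinkhornMap_sub_le_dblOn hγ hG hX hα'X hαX hf' (hcy y₁ hy₁)
    (fun x hx => hcM x hx y₁ hy₁) (hcL y₁ hy₁) hfM' hfG'
  have hst₂ := sinkhornMap_sub_le_dblOn hγ hG hX hαX hα'X hf' (hcy y₂ hy₂)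
    (fun x hx => hcM x hx y₂ hy₂) (hcL y₂ hy₂) hfM' hfG'
  rw [← hgA' y₁ hy₁, dblOn_comm, ← hK] at hst₁
  rw [← hgA' y₂ hy₂, ← hK] at hst₂
  rw [← hgA y₁ hy₁, ← hgA y₂ hy₂, ← hκ] at hcontr
  have hκD : κ * D ≤ 2 * K * dblOn X α α' := by
    have h1 : 0 ≤ κ * ((1 - κ) * D) :=
      mul_nonneg hκ0.le (mul_nonneg (sub_nonneg.2 hκ1) hD0)
    linarith
  have hDle : D ≤ Real.exp (2 * Mc / γ) * (2 * K) * dblOn X α α' := by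
    have h := mul_le_mul_of_nonneg_left hκD (Real.exp_pos (2 * Mc / γ)).le
    rw [← mul_assoc, hκ, ← Real.exp_add, add_neg_cancel, Real.exp_zero, one_mul] at h
    linarith
  have hD2M : D ≤ 2 * Mc := by
    linarith [hgosc y₁ hy₁ y₂ hy₂, hgosc' y₂ hy₂ y₁ hy₁]
  have hexp : Real.exp (D / γ) - 1 ≤ Real.exp (2 * Mc / γ) / γ * D := by
    have h := abs_exp_sub_exp_le (a := D / γ) (b := 0) (B := 2 * Mc / γ) (by gcongr)
      (by positivity)
    rw [Real.exp_zero, sub_zero, abs_of_nonneg (div_nonneg hD0 hγ.le)] at h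
    calc _ ≤ _ := le_abs_self _
      _ ≤ _ := h
      _ = _ := by ring
  have hnhds : ∀ᶠ z in nhds x, z ∈ X := mem_interior_iff_mem_nhds.1 hx
  have hgrad := (hasGradientAt_sinkhornMap hγ hX hβX hg hcx hcM hDc hDcx hDcG
    hx).congr_of_eventuallyEq (hnhds.mono hfA)
  have hgrad' := (hasGradientAt_sinkhornMap hγ hX hβX hg' hcx hcM hDc hDcx hDcG
    hx).congr_of_eventuallyEq (hnhds.mono hfA')
  rw [hgrad.gradient, hgrad'.gradient]
  calc _ ≤ Gc * (Real.exp (D / γ) - 1) :=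
        norm_gibbs_average_sub_le hγ hX hβX hg hg' (hcx x hxX) (hDcx x hx) (hDcG x hx) hmin hgD
    _ ≤ Gc * (Real.exp (2 * Mc / γ) / γ *
          (Real.exp (2 * Mc / γ) * (2 * K) * dblOn X α α')) := by
        refine mul_le_mul_of_nonneg_left (hexp.trans ?_) hG
        exact mul_le_mul_of_nonneg_left hDle (by positivity)
    _ = _ := by ring
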